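/- For every convex body K ⊂ ℝ^N, the center of mass M_K = (1/|K|) ∫_K y dy belongs to the heart ♥(K). -/

import Mathlib

open MeasureTheory Set Metric
open scoped RealInnerProductSpace ENNReal NNReal

noncomputable section

/-- Reflection of `x` across the hyperplane `{z : ⟪z, ω⟫ = l}` (for a unit vector `ω`). -/
def reflectH {N : ℕ} (l : ℝ) (ω x : EuclideanSpace ℝ (Fin N)) : EuclideanSpace ℝ (Fin N) :=
  x + (2 * (l - ⟪x, ω⟫)) • ω

/-- The maximal folding function of a set `K`:
`R_K(ω) = inf {l : the reflection of K ∩ {⟪·,ω⟫ ≥ l} across {⟪·,ω⟫ = l} lies in K}`. -/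
def foldingFn {N : ℕ} (K : Set (EuclideanSpace ℝ (Fin N))) (ω : EuclideanSpace ℝ (Fin N)) : ℝ :=
  sInf {l : ℝ | reflectH l ω '' {x ∈ K | l ≤ ⟪x, ω⟫} ⊆ K}

/-- The heart of a set `K`. -/
def heart {N : ℕ} (K : Set (EuclideanSpace ℝ (Fin N))) : Set (EuclideanSpace ℝ (Fin N)) :=
  {x ∈ K | ∀ ω : EuclideanSpace ℝ (Fin N), ‖ω‖ = 1 → ⟪x, ω⟫ ≤ foldingFn K ω}

/-- The center of mass of `K` (w.r.t. Lebesgue measure). -/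
def centerOfMass {N : ℕ} (K : Set (EuclideanSpace ℝ (Fin N))) : EuclideanSpace ℝ (Fin N) :=
  (volume K).toReal⁻¹ • ∫ y in K, y

theorem reflectH_eq_add_reflection {N : ℕ} (l : ℝ) {ω : EuclideanSpace ℝ (Fin N)} (hω : ‖ω‖ = 1)
    (x : EuclideanSpace ℝ (Fin N)) :
    reflectH l ω x = (2 * l) • ω + (ℝ ∙ ω)ᗮ.reflection x := by
  rw [Submodule.reflection_orthogonal_apply, Submodule.reflection_singleton_apply, hω,
    real_inner_comm, reflectH]
  simp only [RCLike.ofReal_real_eq_id, id_eq, one_pow, div_one]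
  module

theorem integral_comp_reflectH {N : ℕ} (l : ℝ) {ω : EuclideanSpace ℝ (Fin N)} (hω : ‖ω‖ = 1)
    (g : EuclideanSpace ℝ (Fin N) → ℝ) :
    ∫ x, g (reflectH l ω x) = ∫ x, g x := by
  simp_rw [reflectH_eq_add_reflection l hω]
  rw [← integral_add_left_eq_self g ((2 * l) • ω)]
  exact (ℝ ∙ ω)ᗮ.reflection.measurePreserving.integral_comp
    (ℝ ∙ ω)ᗮ.reflection.toHomeomorph.measurableEmbedding (fun x => g ((2 * l) • ω + x))

theorem integrable_comp_reflectH {N : ℕ} (l : ℝ) {ω : EuclideanSpace ℝ (Fin N)} (hω : ‖ω‖ = 1)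
    {g : EuclideanSpace ℝ (Fin N) → ℝ} (hg : Integrable g) :
    Integrable fun x => g (reflectH l ω x) := by
  simp_rw [reflectH_eq_add_reflection l hω]
  exact (ℝ ∙ ω)ᗮ.reflection.measurePreserving.integrable_comp_of_integrable
    (hg.comp_add_left ((2 * l) • ω))

theorem inner_reflectH {N : ℕ} (l : ℝ) {ω : EuclideanSpace ℝ (Fin N)} (hω : ‖ω‖ = 1)
    (x : EuclideanSpace ℝ (Fin N)) :
    ⟪reflectH l ω x, ω⟫ = 2 * l - ⟪x, ω⟫ := by
  rw [reflectH, inner_add_left, real_inner_smul_left, real_inner_self_eq_norm_sq, hω]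
  ring

theorem reflectH_reflectH {N : ℕ} (l : ℝ) {ω : EuclideanSpace ℝ (Fin N)} (hω : ‖ω‖ = 1)
    (x : EuclideanSpace ℝ (Fin N)) :
    reflectH l ω (reflectH l ω x) = x := by
  rw [reflectH, inner_reflectH l hω, reflectH]
  module

/-- If the part of `K` above a hyperplane folds into `K`, the first moment of `K` with respect to
that hyperplane is nonpositive. -/
theorem setIntegral_inner_sub_nonpos {N : ℕ} {K : Set (EuclideanSpace ℝ (Fin N))}
    (hK : IsCompact K) {l : ℝ} {ω : EuclideanSpace ℝ (Fin N)} (hω : ‖ω‖ = 1)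
    (hl : reflectH l ω '' {x ∈ K | l ≤ ⟪x, ω⟫} ⊆ K) :
    ∫ y in K, (⟪y, ω⟫ - l) ≤ 0 := by
  set g : EuclideanSpace ℝ (Fin N) → ℝ := K.indicator fun y => ⟪y, ω⟫ - l with hg
  have hgi : Integrable g := by
    refine IntegrableOn.integrable_indicator ?_ hK.measurableSet
    exact ContinuousOn.integrableOn_compact hK (by fun_prop)
  rw [← integral_indicator hK.measurableSet]
  have hsum : ∫ x, (g x + g (reflectH l ω x)) ≤ 0 := by
    refine integral_nonpos fun x => ?_
    have hfold : ∀ y ∈ K, l ≤ ⟪y, ω⟫ → reflectH l ω y ∈ K :=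
      fun y hy hly => hl ⟨y, ⟨hy, hly⟩, rfl⟩
    have hinner := inner_reflectH l hω x
    have hback : reflectH l ω x ∈ K → ⟪x, ω⟫ < l → x ∈ K := fun hx hlt => by
      simpa only [reflectH_reflectH l hω] using hfold _ hx (by linarith)
    have hforth := hfold x
    classical
    simp only [hg, indicator_apply, Pi.zero_apply]
    split_ifs with h1 h2 h2
    · linarith
    · by_contra! h
      exact h2 (hforth h1 (by linarith))
    · by_contra! h
      exact h1 (hback h2 (by linarith))
    · simp
  rw [integral_add hgi (integrable_comp_reflectH l hω hgi), integral_comp_reflectH l hω] at hsum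
  linarith

theorem centerOfMass_mem {N : ℕ} {K : Set (EuclideanSpace ℝ (Fin N))}
    (hK : IsCompact K) (hconv : Convex ℝ K) (h0 : volume K ≠ 0) :
    centerOfMass K ∈ K := by
  have h := hconv.set_average_mem hK.isClosed h0 hK.measure_lt_top.ne
    (ae_restrict_mem hK.measurableSet)
    (ContinuousOn.integrableOn_compact (f := fun y => y) hK continuousOn_id)
  rwa [setAverage_eq] at h

theorem inner_centerOfMass_le {N : ℕ} {K : Set (EuclideanSpace ℝ (Fin N))}
    (hK : IsCompact K) (h0 : volume K ≠ 0) {l : ℝ} {ω : EuclideanSpace ℝ (Fin N)} (hω : ‖ω‖ = 1)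
    (hl : reflectH l ω '' {x ∈ K | l ≤ ⟪x, ω⟫} ⊆ K) :
    ⟪centerOfMass K, ω⟫ ≤ l := by
  have hint : IntegrableOn (fun y : EuclideanSpace ℝ (Fin N) => y) K :=
    ContinuousOn.integrableOn_compact hK continuousOn_id
  have hpos : 0 < (volume K).toReal := ENNReal.toReal_pos h0 hK.measure_lt_top.ne
  have h := setIntegral_inner_sub_nonpos hK hω hl
  have hconst : Integrable (fun _ : EuclideanSpace ℝ (Fin N) => l) (volume.restrict K) :=
    integrableOn_const hK.measure_lt_top.ne
  rw [integral_sub (hint.inner_const ω) hconst, setIntegral_const, smul_eq_mul,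
    measureReal_def] at h
  have hinner : ∫ y in K, ⟪y, ω⟫ = ⟪∫ y in K, y, ω⟫ := by
    simp_rw [real_inner_comm ω]
    exact integral_inner hint ω
  rw [centerOfMass, real_inner_smul_left, inv_mul_le_iff₀ hpos, ← hinner]
  linarith

theorem foldingFn_set_nonempty {N : ℕ} {K : Set (EuclideanSpace ℝ (Fin N))}
    (hK : IsCompact K) (ω : EuclideanSpace ℝ (Fin N)) :
    {l : ℝ | reflectH l ω '' {x ∈ K | l ≤ ⟪x, ω⟫} ⊆ K}.Nonempty := by
  obtain ⟨b, hb⟩ := hK.bddAbove_image (f := fun x => ⟪x, ω⟫) (by fun_prop)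
  refine ⟨b + 1, ?_⟩
  rintro _ ⟨x, ⟨hxK, hx⟩, rfl⟩
  have hxb : ⟪x, ω⟫ ≤ b := hb (mem_image_of_mem _ hxK)
  linarith

/-- The center of mass of a convex body belongs to its heart. -/
theorem statement2 {N : ℕ} (K : Set (EuclideanSpace ℝ (Fin N)))
    (hKcpt : IsCompact K) (hKconv : Convex ℝ K) (hKint : (interior K).Nonempty) :
    centerOfMass K ∈ heart K := by
  have h0 : volume K ≠ 0 := (Measure.measure_pos_of_nonempty_interior _ hKint).ne'
  exact ⟨centerOfMass_mem hKcpt hKconv h0, fun ω hω =>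
    le_csInf (foldingFn_set_nonempty hKcpt ω) fun l hl => inner_centerOfMass_le hKcpt h0 hω hl⟩
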